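/- arXiv:1312.4337 — 2 statements merged into one kernel-verified Lean document; each statement's English description precedes it below -/
import Mathlib

section
/- Let m ≥ 0 be an integer and set B_m = max_{0 ≤ k ≤ m} A_k, where A_k = 2^{k/2} Γ((k+1)/2)/√π. For every t ∈ (0,T], every multi-index β ∈ ℕⁿ with β_j ≤ m for all j, and all x, ξ ∈ ℝⁿ, one has |∂_ξ^β u(x,ξ,t)| ≤ B_m^{|β|} t^{|β|/2}. -/
open MeasureTheory ProbabilityTheory

/-- `expNeg L = e^{-L}` for `L ∈ [0,∞]`, with the convention `e^{-∞} = 0`. -/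
noncomputable def expNeg (L : ENNReal) : ℝ := if L = ⊤ then 0 else Real.exp (-L.toReal)

/-- Partial derivative in the `j`-th coordinate. -/
noncomputable def pd {ι : Type*} [DecidableEq ι] {E : Type*} [NormedAddCommGroup E]
    [NormedSpace ℝ E] (j : ι) (f : (ι → ℝ) → E) : (ι → ℝ) → E :=
  fun x => deriv (fun s : ℝ => f (Function.update x j s)) (x j)

/-- Iterated partial derivative `∂^β` associated with a multi-index `β`. -/
noncomputable def mderiv {ι : Type*} [Fintype ι] [DecidableEq ι] {E : Type*}
    [NormedAddCommGroup E] [NormedSpace ℝ E] (β : ι → ℕ) (f : (ι → ℝ) → E) : (ι → ℝ) → E :=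
  (Finset.univ : Finset ι).toList.foldr (fun j g => (pd j)^[β j] g) f

/-- `β! = ∏ j (β j)!` for a multi-index `β`. -/
def mfact {ι : Type*} [Fintype ι] (β : ι → ℕ) : ℕ := ∏ j, (β j).factorial

/-- `A k = 2^{k/2} Γ((k+1)/2) / √π`. -/
noncomputable def A (k : ℕ) : ℝ :=
  (2 : ℝ) ^ ((k : ℝ) / 2) * Real.Gamma (((k : ℝ) + 1) / 2) / Real.sqrt Real.pi

/-- `B m = max_{0 ≤ k ≤ m} A k`. -/
noncomputable def B (m : ℕ) : ℝ := ⨆ k : Fin (m + 1), A k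

/-- The hypotheses that `W` is an `n`-dimensional Brownian motion on `[0,T]`. -/
structure IsBrownian (n : ℕ) (T : ℝ) {Ω : Type*} [MeasurableSpace Ω]
    (P : Measure Ω) (W : ℝ → Ω → Fin n → ℝ) : Prop where
  meas : ∀ s : ℝ, Measurable (W s)
  start : ∀ᵐ ω ∂P, W 0 ω = 0
  cont : ∀ᵐ ω ∂P, ContinuousOn (fun s => W s ω) (Set.Icc 0 T)
  indepIncr : ∀ (m : ℕ) (τ : Fin (m + 1) → ℝ), Monotone τ → (∀ i, τ i ∈ Set.Icc 0 T) →
    iIndepFun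
      (fun i : Fin m => fun ω => W (τ i.succ) ω - W (τ i.castSucc) ω) P
  gaussCoord : ∀ s t : ℝ, 0 ≤ s → s ≤ t → t ≤ T → ∀ j : Fin n,
    P.map (fun ω => W t ω j - W s ω j) = gaussianReal 0 ((t - s).toNNReal)
  coordIndep : ∀ s t : ℝ, 0 ≤ s → s ≤ t → t ≤ T →
    iIndepFun (fun j : Fin n => fun ω => W t ω j - W s ω j) P

/-- The Feynman–Kac integrand `e^{-i W(t)·ξ} e^{-∫₀ᵗ V(x - W(t)/2 + W(s)) ds}`. -/
noncomputable def FK {n : ℕ} {Ω : Type*} (W : ℝ → Ω → Fin n → ℝ) (V : (Fin n → ℝ) → ℝ)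
    (t : ℝ) (x ξ : Fin n → ℝ) (ω : Ω) : ℂ :=
  Complex.exp (-(Complex.I * ((∑ j, W t ω j * ξ j : ℝ) : ℂ))) *
    ((expNeg (∫⁻ s in Set.Ioc (0 : ℝ) t,
        ENNReal.ofReal (V (fun j => x j - W t ω j / 2 + W s ω j))) : ℝ) : ℂ)

/-- The Weyl symbol `u(x, ξ, t)` of `e^{-tH}` given by the Feynman–Kac formula. -/
noncomputable def uSym {n : ℕ} {Ω : Type*} [MeasurableSpace Ω] (P : Measure Ω)
    (W : ℝ → Ω → Fin n → ℝ) (V : (Fin n → ℝ) → ℝ) (t : ℝ) (x ξ : Fin n → ℝ) : ℂ :=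
  ∫ ω, FK W V t x ξ ω ∂P

/-- The finite set of nonzero multi-indices `β` with `β ≤ α` (componentwise). -/
def lowerMulti {ι : Type*} [Fintype ι] [DecidableEq ι] (α : ι → ℕ) : Finset (ι → ℕ) :=
  (Finset.Iic α).erase 0

/-- The Constantine–Savits index set `F(α)`: functions `φ` on the nonzero multi-indices
`β ≤ α` (extended by `0` elsewhere) such that `∑_{0 ≠ β ≤ α} φ(β)·β = α`. -/
def FaaF {ι : Type*} [Fintype ι] [DecidableEq ι] (α : ι → ℕ) : Set ((ι → ℕ) → ℕ) :=
  {φ | (∀ β, β ∉ lowerMulti α → φ β = 0) ∧ ∑ β ∈ lowerMulti α, φ β • β = α}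

/-- `|S(α)|`: the number of sites `j` with `α j ≠ 0`. -/
def suppCard {ι : Type*} [Fintype ι] (α : ι → ℕ) : ℕ :=
  (Finset.univ.filter fun j => α j ≠ 0).card


lemma gauss_abs_moment (t : ℝ) (ht : 0 < t) (k : ℕ) :
    ∫ x, |x| ^ k ∂(gaussianReal 0 t.toNNReal) = A k * t ^ ((k : ℝ) / 2) := by
  have hv : t.toNNReal ≠ 0 := by simpa using ht
  have h2t : (0 : ℝ) < 1 / (2 * t) := by positivity
  rw [integral_gaussianReal_eq_integral_smul hv]
  have h1 : ∀ x : ℝ, gaussianPDFReal 0 t.toNNReal x • |x| ^ k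
      = (fun y : ℝ => (√(2 * Real.pi * t))⁻¹ *
          (y ^ (k : ℝ) * Real.exp (-(1 / (2 * t)) * y ^ (2 : ℝ)))) |x| := by
    intro x
    simp only [gaussianPDFReal_def, Real.coe_toNNReal t ht.le, smul_eq_mul, Real.rpow_natCast,
      Real.rpow_two, sq_abs, sub_zero]
    have : -x ^ 2 / (2 * t) = -(1 / (2 * t)) * x ^ 2 := by ring
    rw [this]; ring
  rw [integral_congr_ae (Filter.Eventually.of_forall h1),
    integral_comp_abs (f := fun y : ℝ => (√(2 * Real.pi * t))⁻¹ *
          (y ^ (k : ℝ) * Real.exp (-(1 / (2 * t)) * y ^ (2 : ℝ)))), integral_const_mul,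
    integral_rpow_mul_exp_neg_mul_rpow (by norm_num) (by have : (0:ℝ) ≤ k := by positivity
                                                         linarith) h2t]
  unfold A
  have e1 : (1 / (2 * t)) ^ (-((k : ℝ) + 1) / 2) = 2 ^ ((k:ℝ)/2) * t ^ ((k:ℝ)/2) * √(2 * t) := by
    rw [one_div, Real.inv_rpow (by positivity), ← Real.rpow_neg (by positivity),
      ← Real.mul_rpow (by norm_num) ht.le, Real.sqrt_eq_rpow, ← Real.rpow_add (by positivity)]
    congr 1; ring
  have e2 : √(2 * Real.pi * t) = √(2 * t) * √Real.pi := by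
    rw [← Real.sqrt_mul (by positivity)]; congr 1; ring
  rw [e1, e2]
  have h3 : √(2 * t) ≠ 0 := by positivity
  have h4 : √Real.pi ≠ 0 := by positivity
  field_simp

lemma A_zero : A 0 = 1 := by
  have h4 : √Real.pi ≠ 0 := by positivity
  simp [A, Real.Gamma_one_half_eq, -one_div, h4]

lemma A_le_B {m k : ℕ} (h : k ≤ m) : A k ≤ B m :=
  le_ciSup (f := fun k : Fin (m + 1) => A k) (Set.finite_range _).bddAbove ⟨k, by omega⟩

lemma one_le_B (m : ℕ) : 1 ≤ B m := A_zero ▸ A_le_B (Nat.zero_le m)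

lemma A_le_B_pow {m k : ℕ} (h : k ≤ m) : A k ≤ B m ^ k := by
  rcases Nat.eq_zero_or_pos k with rfl | hk
  · simp [A_zero]
  · exact (A_le_B h).trans (le_self_pow₀ (one_le_B m) hk.ne')

section G

variable {n : ℕ} {Ω : Type*} [MeasurableSpace Ω] (P : Measure Ω) [IsProbabilityMeasure P]
  (X : Ω → Fin n → ℝ) (F : Ω → ℝ)

lemma prod_moment (t : ℝ) (ht : 0 < t) (hX : Measurable X)
    (hg : ∀ j, P.map (fun ω => X ω j) = gaussianReal 0 t.toNNReal)
    (hi : iIndepFun (fun j ω => X ω j) P) (γ : Fin n → ℕ) :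
    Integrable (fun ω => ∏ j, |X ω j| ^ γ j) P ∧
    ∫ ω, ∏ j, |X ω j| ^ γ j ∂P = ∏ j, (A (γ j) * t ^ ((γ j : ℝ) / 2)) := by
  have hXj : ∀ j, AEMeasurable (fun ω => X ω j) P :=
    fun j => ((measurable_pi_apply j).comp hX).aemeasurable
  have hmap := hi.map_fun_eq_pi_map hXj
  constructor
  · have : Integrable (fun y : Fin n → ℝ => ∏ j, |y j| ^ γ j)
        (Measure.pi (fun j => P.map (fun ω => X ω j))) := by
      have : ∀ j, IsProbabilityMeasure (P.map (fun ω => X ω j)) :=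
        fun j => Measure.isProbabilityMeasure_map (hXj j)
      refine Integrable.fintype_prod (f := fun j (y : ℝ) => |y| ^ γ j) (fun j => ?_)
      rw [hg j]
      have := (memLp_id_gaussianReal (μ := 0) (v := t.toNNReal) (γ j)).integrable_norm_pow'
      simpa using this
    rw [← hmap] at this
    exact this.comp_measurable hX
  · rw [hi.integral_fun_prod_comp (f := fun j (y : ℝ) => |y| ^ γ j) hXj
      (fun j => by fun_prop)]
    refine Finset.prod_congr rfl (fun j _ => ?_)
    rw [← gauss_abs_moment t ht, ← hg j, integral_map (hXj j) (by fun_prop)]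

noncomputable def Gi (γ : Fin n → ℕ) (ξ : Fin n → ℝ) (ω : Ω) : ℂ :=
  (∏ j, (-(Complex.I * (X ω j : ℂ))) ^ γ j) *
    (Complex.exp (-(Complex.I * ((∑ j, X ω j * ξ j : ℝ) : ℂ))) * (F ω : ℂ))

noncomputable def GG (γ : Fin n → ℕ) (ξ : Fin n → ℝ) : ℂ := ∫ ω, Gi X F γ ξ ω ∂P

lemma norm_Gi_le (hF : ∀ ω, |F ω| ≤ 1) (γ : Fin n → ℕ) (ξ : Fin n → ℝ) (ω : Ω) :
    ‖Gi X F γ ξ ω‖ ≤ ∏ j, |X ω j| ^ γ j := by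
  have h1 : ‖Complex.exp (-(Complex.I * ((∑ j, X ω j * ξ j : ℝ) : ℂ)))‖ = 1 := by
    rw [Complex.norm_exp]; simp
  unfold Gi
  rw [norm_mul, norm_mul, h1, one_mul, norm_prod]
  simp only [norm_pow, norm_neg, norm_mul, Complex.norm_I, one_mul, Complex.norm_real,
    Real.norm_eq_abs]
  exact mul_le_of_le_one_right (by positivity) (hF ω)

lemma meas_Gi (hX : Measurable X) (hF : AEStronglyMeasurable F P) (γ : Fin n → ℕ)
    (ξ : Fin n → ℝ) : AEStronglyMeasurable (Gi X F γ ξ) P := by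
  unfold Gi
  refine AEStronglyMeasurable.mul (Measurable.aestronglyMeasurable (by fun_prop))
    (AEStronglyMeasurable.mul (Measurable.aestronglyMeasurable (by fun_prop)) ?_)
  exact Complex.continuous_ofReal.comp_aestronglyMeasurable hF

lemma deriv_Gi (j : Fin n) (γ : Fin n → ℕ) (ξ : Fin n → ℝ) (ω : Ω) (s : ℝ) :
    HasDerivAt (fun s : ℝ => Gi X F γ (Function.update ξ j s) ω)
      (Gi X F (γ + Pi.single j 1) (Function.update ξ j s) ω) s := by
  have hs : HasDerivAt (fun s : ℝ => ∑ i, X ω i * Function.update ξ j s i) (X ω j) s := by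
    have := HasDerivAt.fun_sum (u := Finset.univ) (fun i _ =>
      ((hasDerivAt_pi.1 (hasDerivAt_update ξ j s)) i).const_mul (X ω i))
    simpa [Pi.single_apply] using this
  have h2 := (((hs.ofReal_comp.const_mul Complex.I).fun_neg.cexp.mul_const
    (F ω : ℂ)).const_mul (∏ i, (-(Complex.I * (X ω i : ℂ))) ^ γ i))
  unfold Gi
  have hp : ∏ i, (-(Complex.I * (X ω i : ℂ))) ^ (γ + Pi.single j 1 : Fin n → ℕ) i
      = (∏ i, (-(Complex.I * (X ω i : ℂ))) ^ γ i) * (-(Complex.I * (X ω j : ℂ))) := by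
    simp only [Pi.add_apply, pow_add, Finset.prod_mul_distrib]
    congr 1
    rw [Finset.prod_eq_single j] <;> simp +contextual
  rw [hp]
  refine h2.congr_deriv ?_
  ring

lemma int_Gi (hX : Measurable X) (hFm : AEStronglyMeasurable F P) (hF : ∀ ω, |F ω| ≤ 1)
    (hint : ∀ γ : Fin n → ℕ, Integrable (fun ω => ∏ j, |X ω j| ^ γ j) P)
    (γ : Fin n → ℕ) (ξ : Fin n → ℝ) : Integrable (Gi X F γ ξ) P :=
  (hint γ).mono' (meas_Gi P X F hX hFm γ ξ) (Filter.Eventually.of_forall (norm_Gi_le X F hF γ ξ))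

lemma hasDeriv_GG (hX : Measurable X) (hFm : AEStronglyMeasurable F P) (hF : ∀ ω, |F ω| ≤ 1)
    (hint : ∀ γ : Fin n → ℕ, Integrable (fun ω => ∏ j, |X ω j| ^ γ j) P)
    (j : Fin n) (γ δ : Fin n → ℕ) (hδ : δ = γ + Pi.single j 1) (ξ : Fin n → ℝ) (s₀ : ℝ) :
    HasDerivAt (fun s => ∫ ω, Gi X F γ (Function.update ξ j s) ω ∂P)
      (∫ ω, Gi X F δ (Function.update ξ j s₀) ω ∂P) s₀ := by
  have hd : ∀ᵐ ω ∂P, ∀ s ∈ (Set.univ : Set ℝ),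
      HasDerivAt (fun s : ℝ => Gi X F γ (Function.update ξ j s) ω)
      (Gi X F δ (Function.update ξ j s) ω) s :=
    Filter.Eventually.of_forall fun ω s _ => hδ ▸ deriv_Gi X F j γ ξ ω s
  have hb : ∀ᵐ ω ∂P, ∀ s ∈ (Set.univ : Set ℝ),
      ‖Gi X F δ (Function.update ξ j s) ω‖ ≤ ∏ i, |X ω i| ^ δ i :=
    Filter.Eventually.of_forall fun ω s _ => norm_Gi_le X F hF _ _ ω
  have hm : ∀ᶠ s in nhds s₀, AEStronglyMeasurable (Gi X F γ (Function.update ξ j s)) P :=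
    Filter.Eventually.of_forall fun s => meas_Gi P X F hX hFm _ _
  exact (hasDerivAt_integral_of_dominated_loc_of_deriv_le
    (F := fun s => Gi X F γ (Function.update ξ j s))
    (F' := fun s => Gi X F δ (Function.update ξ j s))
    Filter.univ_mem hm (int_Gi P X F hX hFm hF hint _ _)
    (meas_Gi P X F hX hFm _ _) hb (hint δ) hd).2

lemma pd_GG (hX : Measurable X) (hFm : AEStronglyMeasurable F P) (hF : ∀ ω, |F ω| ≤ 1)
    (hint : ∀ γ : Fin n → ℕ, Integrable (fun ω => ∏ j, |X ω j| ^ γ j) P)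
    (j : Fin n) (γ : Fin n → ℕ) :
    pd j (GG P X F γ) = GG P X F (γ + Pi.single j 1) := by
  funext ξ
  have h3 := (hasDeriv_GG P X F hX hFm hF hint j γ _ rfl ξ (ξ j)).deriv
  rw [Function.update_eq_self] at h3
  exact h3

lemma pd_iter_GG (hX : Measurable X) (hFm : AEStronglyMeasurable F P) (hF : ∀ ω, |F ω| ≤ 1)
    (hint : ∀ γ : Fin n → ℕ, Integrable (fun ω => ∏ j, |X ω j| ^ γ j) P)
    (j : Fin n) (k : ℕ) (γ : Fin n → ℕ) :
    (pd j)^[k] (GG P X F γ) = GG P X F (γ + Pi.single j k) := by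
  induction k with
  | zero => simp
  | succ k ih =>
    rw [Function.iterate_succ_apply', ih, pd_GG P X F hX hFm hF hint, add_assoc, ← Pi.single_add]

lemma foldr_GG (hX : Measurable X) (hFm : AEStronglyMeasurable F P) (hF : ∀ ω, |F ω| ≤ 1)
    (hint : ∀ γ : Fin n → ℕ, Integrable (fun ω => ∏ j, |X ω j| ^ γ j) P)
    (β : Fin n → ℕ) (l : List (Fin n)) :
    l.foldr (fun j g => (pd j)^[β j] g) (GG P X F 0)
      = GG P X F ((l.map (fun j => (Pi.single j (β j) : Fin n → ℕ))).sum) := by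
  induction l with
  | nil => simp
  | cons a l ih =>
    rw [List.foldr_cons, ih, pd_iter_GG P X F hX hFm hF hint, List.map_cons, List.sum_cons,
      add_comm]

lemma mderiv_GG (hX : Measurable X) (hFm : AEStronglyMeasurable F P) (hF : ∀ ω, |F ω| ≤ 1)
    (hint : ∀ γ : Fin n → ℕ, Integrable (fun ω => ∏ j, |X ω j| ^ γ j) P)
    (β : Fin n → ℕ) : mderiv β (GG P X F 0) = GG P X F β := by
  unfold mderiv
  rw [foldr_GG P X F hX hFm hF hint, Finset.sum_map_toList, Finset.univ_sum_single]

end G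

lemma pd_zero {n : ℕ} (j : Fin n) : pd j (fun _ : Fin n → ℝ => (0 : ℂ)) = fun _ => 0 := by
  funext x; simp [pd]

lemma mderiv_zero {n : ℕ} (β : Fin n → ℕ) :
    mderiv β (fun _ : Fin n → ℝ => (0 : ℂ)) = fun _ => 0 := by
  unfold mderiv
  generalize (Finset.univ : Finset (Fin n)).toList = l
  induction l with
  | nil => rfl
  | cons a l ih => rw [List.foldr_cons, ih, Function.iterate_fixed (pd_zero a)]

lemma abs_expNeg_le (L : ENNReal) : |expNeg L| ≤ 1 := by
  unfold expNeg
  split_ifs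
  · simp
  · rw [abs_of_pos (Real.exp_pos _)]; simp

/-- For `m ≥ 0`, `B_m = max_{0 ≤ k ≤ m} A_k`; for every `t ∈ (0,T]`, every
multi-index `β` with `β_j ≤ m` for all `j`, and all `x, ξ`,
`|∂_ξ^β u(x,ξ,t)| ≤ B_m^{|β|} t^{|β|/2}`. -/
theorem weyl_symbol_xi_deriv_bound_uniform
    (n : ℕ) (hn : 1 ≤ n) (T : ℝ) (hT : 0 < T)
    {Ω : Type*} [MeasurableSpace Ω] (P : Measure Ω) [IsProbabilityMeasure P]
    (W : ℝ → Ω → Fin n → ℝ) (hW : IsBrownian n T P W)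
    (V : (Fin n → ℝ) → ℝ) (hV0 : ∀ y, 0 ≤ V y) (hVmeas : Measurable V)
    (m : ℕ) (t : ℝ) (ht : t ∈ Set.Ioc (0 : ℝ) T)
    (β : Fin n → ℕ) (hβ : ∀ j, β j ≤ m) (x ξ : Fin n → ℝ) :
    ‖mderiv β (fun ξ' : Fin n → ℝ => uSym P W V t x ξ') ξ‖ ≤
      B m ^ (∑ j, β j) * t ^ (((∑ j, β j : ℕ) : ℝ) / 2) := by
  obtain ⟨ht0, htT⟩ := ht
  have hB := one_le_B m
  have hRHS : 0 ≤ B m ^ (∑ j, β j) * t ^ (((∑ j, β j : ℕ) : ℝ) / 2) := by positivity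
  set F : Ω → ℝ := fun ω => expNeg (∫⁻ s in Set.Ioc (0 : ℝ) t,
        ENNReal.ofReal (V (fun j => x j - W t ω j / 2 + W s ω j))) with hFdef
  have hF : ∀ ω, |F ω| ≤ 1 := fun ω => abs_expNeg_le _
  have hX : Measurable (W t) := hW.meas t
  have hu : (fun ξ' : Fin n → ℝ => uSym P W V t x ξ') = GG P (W t) F 0 := by
    funext ξ'
    simp [uSym, GG, Gi, FK, hFdef]
  rw [hu]
  by_cases hFm : AEStronglyMeasurable F P
  · have hae : ∀ j, (fun ω => W t ω j - W 0 ω j) =ᵐ[P] fun ω => W t ω j := fun j => by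
      filter_upwards [hW.start] with ω h
      simp [h]
    have hg : ∀ j, P.map (fun ω => W t ω j) = gaussianReal 0 t.toNNReal := fun j => by
      rw [← Measure.map_congr (hae j), hW.gaussCoord 0 t le_rfl ht0.le htT j, sub_zero]
    have hi : iIndepFun (fun j ω => W t ω j) P :=
      (hW.coordIndep 0 t le_rfl ht0.le htT).congr hae
    have hint := fun γ => (prod_moment P (W t) t ht0 hX hg hi γ).1
    rw [mderiv_GG P (W t) F hX hFm hF hint β]
    calc ‖GG P (W t) F β ξ‖ ≤ ∫ ω, ∏ j, |W t ω j| ^ β j ∂P :=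
          norm_integral_le_of_norm_le (hint β)
            (Filter.Eventually.of_forall (norm_Gi_le (W t) F hF β ξ))
      _ = ∏ j, (A (β j) * t ^ ((β j : ℝ) / 2)) := (prod_moment P (W t) t ht0 hX hg hi β).2
      _ = (∏ j, A (β j)) * t ^ (((∑ j, β j : ℕ) : ℝ) / 2) := by
          rw [Finset.prod_mul_distrib, ← Real.rpow_sum_of_pos ht0, Nat.cast_sum, Finset.sum_div]
      _ ≤ _ := by
          rw [← Finset.prod_pow_eq_pow_sum]
          refine mul_le_mul_of_nonneg_right (Finset.prod_le_prod (fun j _ => ?_)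
            (fun j _ => A_le_B_pow (hβ j))) (by positivity)
          have : 0 < Real.Gamma (((β j : ℝ) + 1) / 2) := Real.Gamma_pos_of_pos (by positivity)
          unfold A; positivity
  · have h0 : GG P (W t) F 0 = fun _ => 0 := by
      funext ξ'
      refine integral_undef fun hI => hFm ?_
      have h1 : AEStronglyMeasurable
          (fun ω => Complex.exp (Complex.I * ((∑ j, W t ω j * ξ' j : ℝ) : ℂ))) P :=
        Measurable.aestronglyMeasurable (by fun_prop)
      have h2 := Complex.continuous_re.comp_aestronglyMeasurable (h1.mul hI.1)
      refine h2.congr (Filter.Eventually.of_forall fun ω => ?_)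
      simp only [Gi, Pi.mul_apply, Pi.zero_apply, pow_zero, Finset.prod_const_one, one_mul]
      rw [← mul_assoc, ← Complex.exp_add]
      simp
    rw [h0, mderiv_zero]
    simpa using hRHS
end

section
/- Let W : ℝⁿ → ℝ be C^∞ with W(x) ≤ 0 for all x, let α ∈ ℕⁿ be a nonzero multi-index, and assume that for every nonzero multi-index β ≤ α the derivative ∂^β W is bounded. Then for every x ∈ ℝⁿ, |∂^α (e^{W})(x)| ≤ α! · exp( Σ_{0 ≠ β ≤ α} ‖∂^β W‖_∞ / β! ), where ‖·‖_∞ denotes the supremum norm on ℝⁿ. -/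
open MeasureTheory ProbabilityTheory

open scoped ContDiff

section helpers
variable {n : ℕ}

lemma pd_eq {f : (Fin n → ℝ) → ℝ} (hf : ContDiff ℝ ∞ f) (j : Fin n) :
    pd j f = fun x => fderiv ℝ f x (Pi.single j 1) := by
  funext x
  have h1 : HasDerivAt (fun s : ℝ => Function.update x j s) (Pi.single j 1) (x j) :=
    hasDerivAt_update x j (x j)
  have h2 : HasFDerivAt f (fderiv ℝ f x) (Function.update x j (x j)) := by
    rw [Function.update_eq_self]
    exact (hf.differentiable (by simp) x).hasFDerivAt
  exact (h2.comp_hasDerivAt (x j) h1).deriv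

lemma pd_smooth {f : (Fin n → ℝ) → ℝ} (hf : ContDiff ℝ ∞ f) (j : Fin n) :
    ContDiff ℝ ∞ (pd j f) := by
  rw [pd_eq hf]
  exact (hf.fderiv_right (m := ∞) (by simp)).clm_apply contDiff_const

lemma pd_comm {f : (Fin n → ℝ) → ℝ} (hf : ContDiff ℝ ∞ f) (i j : Fin n) :
    pd i (pd j f) = pd j (pd i f) := by
  rw [pd_eq (pd_smooth hf j), pd_eq (pd_smooth hf i), pd_eq hf, pd_eq hf]
  funext x
  have hd : DifferentiableAt ℝ (fderiv ℝ f) x :=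
    (hf.fderiv_right (m := ∞) (by simp)).differentiable (by simp) x
  have hs : IsSymmSndFDerivAt ℝ f x :=
    hf.contDiffAt.isSymmSndFDerivAt (by
      simp only [minSmoothness_of_isRCLikeNormedField]
      exact WithTop.coe_le_coe.2 (le_top : (2 : ℕ∞) ≤ ⊤))
  rw [fderiv_clm_apply hd (differentiableAt_const _), fderiv_clm_apply hd (differentiableAt_const _)]
  simpa using hs.eq (Pi.single i 1) (Pi.single j 1)

lemma pd_add {f g : (Fin n → ℝ) → ℝ} (hf : ContDiff ℝ ∞ f) (hg : ContDiff ℝ ∞ g) (j : Fin n) :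
    pd j (fun x => f x + g x) = fun x => pd j f x + pd j g x := by
  rw [pd_eq (hf.add hg), pd_eq hf, pd_eq hg]
  funext x
  rw [fderiv_fun_add (hf.differentiable (by simp) x) (hg.differentiable (by simp) x)]
  rfl

lemma pd_mul {f g : (Fin n → ℝ) → ℝ} (hf : ContDiff ℝ ∞ f) (hg : ContDiff ℝ ∞ g) (j : Fin n) :
    pd j (fun x => f x * g x) = fun x => pd j f x * g x + f x * pd j g x := by
  rw [pd_eq (hf.mul hg), pd_eq hf, pd_eq hg]
  funext x
  rw [fderiv_fun_mul (hf.differentiable (by simp) x) (hg.differentiable (by simp) x)]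
  simp
  ring

lemma pd_exp {f : (Fin n → ℝ) → ℝ} (hf : ContDiff ℝ ∞ f) (j : Fin n) :
    pd j (fun x => Real.exp (f x)) = fun x => pd j f x * Real.exp (f x) := by
  rw [pd_eq hf.exp, pd_eq hf]
  funext x
  rw [fderiv_exp (hf.differentiable (by simp) x)]
  simp
  ring

lemma pd_iter {f : (Fin n → ℝ) → ℝ} (hf : ContDiff ℝ ∞ f) (i j : Fin n) (k : ℕ) :
    ContDiff ℝ ∞ ((pd i)^[k] f) ∧ (pd i)^[k] (pd j f) = pd j ((pd i)^[k] f) := by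
  induction k with
  | zero => exact ⟨hf, rfl⟩
  | succ k ih =>
    rw [Function.iterate_succ_apply', Function.iterate_succ_apply', ih.2]
    exact ⟨pd_smooth ih.1 i, pd_comm ih.1 i j⟩

lemma fold_comm {f : (Fin n → ℝ) → ℝ} (hf : ContDiff ℝ ∞ f) (j : Fin n) (α : Fin n → ℕ)
    (l : List (Fin n)) :
    ContDiff ℝ ∞ (l.foldr (fun j g => (pd j)^[α j] g) f) ∧
    l.foldr (fun j g => (pd j)^[α j] g) (pd j f) = pd j (l.foldr (fun j g => (pd j)^[α j] g) f) := by
  induction l with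
  | nil => exact ⟨hf, rfl⟩
  | cons i t ih =>
    simp only [List.foldr_cons]
    rw [ih.2]
    exact pd_iter ih.1 i j _

lemma fold_notMem {f : (Fin n → ℝ) → ℝ} (j : Fin n) (α : Fin n → ℕ)
    (l : List (Fin n)) (hl : j ∉ l) :
    l.foldr (fun i g => (pd i)^[(α + Pi.single j 1 : Fin n → ℕ) i] g) f =
      l.foldr (fun j g => (pd j)^[α j] g) f := by
  induction l with
  | nil => rfl
  | cons i t ih =>
    simp only [List.mem_cons, not_or] at hl
    simp only [List.foldr_cons]
    rw [ih hl.2]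
    have : (α + Pi.single j 1 : Fin n → ℕ) i = α i := by
      simp [Pi.single_apply, Ne.symm hl.1]
    rw [this]

lemma fold_succ {f : (Fin n → ℝ) → ℝ} (hf : ContDiff ℝ ∞ f) (j : Fin n) (α : Fin n → ℕ)
    (l : List (Fin n)) (hl : l.Nodup) (hj : j ∈ l) :
    l.foldr (fun i g => (pd i)^[(α + Pi.single j 1 : Fin n → ℕ) i] g) f =
      l.foldr (fun j g => (pd j)^[α j] g) (pd j f) := by
  induction l with
  | nil => simp at hj
  | cons i t ih =>
    rw [List.nodup_cons] at hl
    simp only [List.foldr_cons]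
    by_cases hij : i = j
    · subst hij
      rw [fold_notMem i α t hl.1, (fold_comm hf i α t).2]
      have : (α + Pi.single i 1 : Fin n → ℕ) i = α i + 1 := by simp
      rw [this, Function.iterate_succ_apply]
    · have hjt : j ∈ t := by
        rcases List.mem_cons.1 hj with h | h
        · exact absurd h.symm hij
        · exact h
      rw [ih hl.2 hjt]
      have : (α + Pi.single j 1 : Fin n → ℕ) i = α i := by
        simp [Pi.single_apply, hij]
      rw [this]

lemma mderiv_succ {f : (Fin n → ℝ) → ℝ} (hf : ContDiff ℝ ∞ f) (j : Fin n) (α : Fin n → ℕ) :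
    mderiv (α + Pi.single j 1) f = mderiv α (pd j f) :=
  fold_succ hf j α _ (Finset.nodup_toList _) (by simp)

lemma mderiv_zero_s11 (f : (Fin n → ℝ) → ℝ) : mderiv 0 f = f := by
  unfold mderiv
  induction (Finset.univ : Finset (Fin n)).toList with
  | nil => rfl
  | cons i t ih => simpa using ih

lemma multi_ind {p : (Fin n → ℕ) → Prop} (h0 : p 0)
    (hs : ∀ α j, p α → p (α + Pi.single j 1)) (α : Fin n → ℕ) : p α := by
  induction hk : ∑ j, α j generalizing α with
  | zero =>
    have : α = 0 := by
      funext j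
      simpa using (Finset.sum_eq_zero_iff.1 hk) j (Finset.mem_univ j)
    rwa [this]
  | succ k ih =>
    obtain ⟨j, hj⟩ : ∃ j, α j ≠ 0 := by
      by_contra! h
      simp [h] at hk
    have he : α = (α - Pi.single j 1) + Pi.single j 1 := by
      funext i
      by_cases h : i = j
      · subst h
        simp
        omega
      · simp [Pi.single_apply, h]
    rw [he]
    apply hs
    apply ih
    rw [he] at hk
    simp only [Pi.add_apply, Finset.sum_add_distrib] at hk
    simp at hk
    simpa using hk

lemma mderiv_add {f g : (Fin n → ℝ) → ℝ} (hf : ContDiff ℝ ∞ f) (hg : ContDiff ℝ ∞ g)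
    (α : Fin n → ℕ) :
    mderiv α (fun x => f x + g x) = fun x => mderiv α f x + mderiv α g x := by
  induction α using multi_ind generalizing f g with
  | h0 => simp [mderiv_zero_s11]
  | hs α j ih =>
    rw [mderiv_succ (hf.add hg), mderiv_succ hf, mderiv_succ hg, pd_add hf hg,
      ih (pd_smooth hf j) (pd_smooth hg j)]

/-- Taylor coefficient. -/
noncomputable def tc (f : (Fin n → ℝ) → ℝ) (x : Fin n → ℝ) (α : Fin n → ℕ) : ℝ :=
  mderiv α f x / (mfact α : ℝ)

lemma mfact_pos (α : Fin n → ℕ) : 0 < (mfact α : ℝ) := by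
  unfold mfact
  exact_mod_cast Finset.prod_pos fun j _ => Nat.factorial_pos _

lemma mfact_succ (α : Fin n → ℕ) (j : Fin n) :
    mfact (α + Pi.single j 1) = (α j + 1) * mfact α := by
  unfold mfact
  rw [← Finset.mul_prod_erase _ _ (Finset.mem_univ j),
    ← Finset.mul_prod_erase Finset.univ (fun j => (α j).factorial) (Finset.mem_univ j), ← mul_assoc]
  congr 1
  · simp [Nat.factorial_succ]
  · apply Finset.prod_congr rfl
    intro i hi
    simp [Pi.single_apply, Finset.ne_of_mem_erase hi]

lemma tc_succ {f : (Fin n → ℝ) → ℝ} (hf : ContDiff ℝ ∞ f) (x) (j : Fin n) (α : Fin n → ℕ) :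
    ((α j : ℝ) + 1) * tc f x (α + Pi.single j 1) = tc (pd j f) x α := by
  unfold tc
  rw [mderiv_succ hf, mfact_succ]
  have := mfact_pos α
  have h2 : (0 : ℝ) < (α j : ℝ) + 1 := by positivity
  push_cast
  field_simp

lemma sum_shift (α : Fin n → ℕ) (j : Fin n) (a b : (Fin n → ℕ) → ℝ) :
    ∑ β ∈ Finset.Iic α, ((β j : ℝ) + 1) * a (β + Pi.single j 1) * b (α - β) =
    ∑ β ∈ Finset.Iic (α + Pi.single j 1), (β j : ℝ) * a β * b (α + Pi.single j 1 - β) := by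
  apply Finset.sum_of_injOn (fun β => β + Pi.single j 1)
  · intro β _ γ _ h
    exact add_right_cancel h
  · intro β hβ
    simp only [Finset.coe_Iic, Set.mem_Iic] at hβ ⊢
    exact add_le_add_left hβ _
  · intro β hβ hn
    by_cases h : β j = 0
    · simp [h]
    · exfalso
      apply hn
      have h1 : Pi.single j 1 ≤ β := by
        intro i
        by_cases hi : i = j
        · subst hi
          simp
          omega
        · simp [Pi.single_apply, hi]
      refine ⟨β - Pi.single j 1, ?_, tsub_add_cancel_of_le h1⟩
      simp only [Finset.coe_Iic, Set.mem_Iic, Finset.mem_Iic] at hβ ⊢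
      exact tsub_le_iff_right.2 hβ
  · intro β hβ
    rw [add_tsub_add_eq_tsub_right]
    simp

lemma sum_shift' (α : Fin n → ℕ) (j : Fin n) (a b : (Fin n → ℕ) → ℝ) :
    ∑ β ∈ Finset.Iic α, a β * ((((α - β) j : ℕ) : ℝ) + 1) * b (α - β + Pi.single j 1) =
    ∑ β ∈ Finset.Iic (α + Pi.single j 1),
      a β * (((α + Pi.single j 1 - β : Fin n → ℕ) j : ℕ) : ℝ) * b (α + Pi.single j 1 - β) := by
  have hsub : Finset.Iic α ⊆ Finset.Iic (α + Pi.single j 1) :=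
    Finset.Iic_subset_Iic.2 le_self_add
  rw [← Finset.sum_subset hsub]
  · apply Finset.sum_congr rfl
    intro β hβ
    rw [Finset.mem_Iic] at hβ
    have h : α + Pi.single j 1 - β = α - β + Pi.single j 1 := by
      rw [tsub_add_eq_add_tsub hβ]
    rw [h]
    simp
  · intro β hβ hn
    rw [Finset.mem_Iic] at hβ hn
    have : (α + Pi.single j 1 - β : Fin n → ℕ) j = 0 := by
      by_contra h
      apply hn
      intro i
      have : β i ≤ (α + Pi.single j 1 : Fin n → ℕ) i := hβ i
      by_cases hi : i = j
      · subst hi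
        simp at h this
        show β i ≤ α i
        omega
      · simpa [Pi.single_apply, hi] using this
    rw [this]
    simp

lemma tc_mul {f g : (Fin n → ℝ) → ℝ} (hf : ContDiff ℝ ∞ f) (hg : ContDiff ℝ ∞ g) (x)
    (α : Fin n → ℕ) :
    tc (fun y => f y * g y) x α = ∑ β ∈ Finset.Iic α, tc f x β * tc g x (α - β) := by
  induction α using multi_ind generalizing f g with
  | h0 =>
    have : Finset.Iic (0 : Fin n → ℕ) = {0} := by
      ext β
      simp
    rw [this]
    simp [tc, mderiv_zero_s11, mfact]
  | hs α j ih =>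
    have h2 : ((α j : ℝ) + 1) ≠ 0 := by positivity
    apply mul_left_cancel₀ h2
    rw [tc_succ (hf.mul hg), pd_mul hf hg]
    have : tc (fun x => pd j f x * g x + f x * pd j g x) x α =
        tc (fun x => pd j f x * g x) x α + tc (fun x => f x * pd j g x) x α := by
      unfold tc
      rw [mderiv_add ((pd_smooth hf j).mul hg) (hf.mul (pd_smooth hg j)), add_div]
    rw [this, ih (pd_smooth hf j) hg, ih hf (pd_smooth hg j)]
    simp_rw [← tc_succ hf, ← tc_succ hg, ← mul_assoc]
    rw [sum_shift, sum_shift', ← Finset.sum_add_distrib, Finset.mul_sum]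
    apply Finset.sum_congr rfl
    intro β hβ
    rw [Finset.mem_Iic] at hβ
    have h : β j ≤ (α + Pi.single j 1 : Fin n → ℕ) j := hβ j
    have h3 : ((α j : ℝ) + 1) = (β j : ℝ) + (((α + Pi.single j 1 - β : Fin n → ℕ) j : ℕ) : ℝ) := by
      simp at h ⊢
      norm_cast
      omega
    rw [h3]
    ring

lemma tc_exp {f : (Fin n → ℝ) → ℝ} (hf : ContDiff ℝ ∞ f) (x) (j : Fin n)
    (α : Fin n → ℕ) :
    (α j : ℝ) * tc (fun y => Real.exp (f y)) x α =
      ∑ β ∈ Finset.Iic α, (β j : ℝ) * tc f x β * tc (fun y => Real.exp (f y)) x (α - β) := by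
  by_cases h : α j = 0
  · rw [Finset.sum_eq_zero]
    · simp [h]
    · intro β hβ
      rw [Finset.mem_Iic] at hβ
      have : β j ≤ α j := hβ j
      have : β j = 0 := by omega
      simp [this]
  · obtain ⟨γ, rfl⟩ : ∃ γ : Fin n → ℕ, α = γ + Pi.single j 1 := by
      refine ⟨α - Pi.single j 1, (tsub_add_cancel_of_le ?_).symm⟩
      intro i
      by_cases hi : i = j
      · subst hi
        simp
        omega
      · simp [Pi.single_apply, hi]
    rw [← sum_shift]
    simp_rw [tc_succ hf]
    rw [← tc_mul (pd_smooth hf j) hf.exp, ← pd_exp hf, ← tc_succ hf.exp]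
    simp

lemma double_sum (α : Fin n → ℕ) (G H : (Fin n → ℕ) → ℝ) (hG : ∀ β ∈ Finset.Iic α, 0 ≤ G β)
    (hH : ∀ β, 0 ≤ H β) :
    ∑ β ∈ Finset.Iic α, ∑ γ ∈ Finset.Iic β, G γ * H (β - γ) ≤
      (∑ γ ∈ Finset.Iic α, G γ) * ∑ δ ∈ Finset.Iic α, H δ := by
  rw [Finset.sum_comm' (t' := Finset.Iic α) (s' := fun γ => Finset.Icc γ α), Finset.sum_mul]
  · apply Finset.sum_le_sum
    intro γ hγ
    rw [← Finset.mul_sum]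
    apply mul_le_mul_of_nonneg_left _ (hG γ hγ)
    rw [← Finset.sum_image (f := H) (g := fun β => β - γ) (s := Finset.Icc γ α)]
    · apply Finset.sum_le_sum_of_subset_of_nonneg
      · intro δ hδ
        simp only [Finset.mem_image, Finset.mem_Icc, Finset.mem_Iic] at hδ ⊢
        obtain ⟨β, hβ, rfl⟩ := hδ
        exact tsub_le_self.trans hβ.2
      · intro i _ _
        exact hH i
    · intro a ha b hb hab
      simp only [Finset.coe_Icc, Set.mem_Icc] at ha hb
      exact (tsub_left_inj ha.1 hb.1).1 hab
  · intro β γ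
    simp only [Finset.mem_Iic, Finset.mem_Icc]
    constructor
    · rintro ⟨h1, h2⟩
      exact ⟨⟨h2, h1⟩, h2.trans h1⟩
    · rintro ⟨⟨h1, h2⟩, _⟩
      exact ⟨h2, h1⟩

lemma gronwall_key (α : Fin n → ℕ) (F w : (Fin n → ℕ) → ℝ) (hF : ∀ β, 0 ≤ F β) (hF0 : F 0 ≤ 1)
    (hw : ∀ β, 0 ≤ w β) (d : (Fin n → ℕ) → ℕ) (hd0 : ∀ β, d β = 0 ↔ β = 0)
    (hd : ∀ β γ, γ ≤ β → d β = d γ + d (β - γ))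
    (h : ∀ β ≤ α, (d β : ℝ) * F β ≤ ∑ γ ∈ Finset.Iic β, (d γ : ℝ) * w γ * F (β - γ)) :
    F α ≤ Real.exp (∑ γ ∈ lowerMulti α, w γ) := by
  set Φ : ℝ → ℝ := fun t => ∑ β ∈ Finset.Iic α, F β * t ^ d β with hΦ
  set P : ℝ → ℝ := fun t => ∑ β ∈ lowerMulti α, w β * t ^ d β with hP
  have dΦ : ∀ t, HasDerivAt Φ (∑ β ∈ Finset.Iic α, F β * (d β * t ^ (d β - 1))) t := fun t =>
    HasDerivAt.fun_sum fun β _ => (hasDerivAt_pow (d β) t).const_mul _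
  have dP : ∀ t, HasDerivAt P (∑ β ∈ lowerMulti α, w β * (d β * t ^ (d β - 1))) t := fun t =>
    HasDerivAt.fun_sum fun β _ => (hasDerivAt_pow (d β) t).const_mul _
  have dh : ∀ t, HasDerivAt (fun t => Φ t * Real.exp (-P t)) _ t := fun t =>
    (dΦ t).mul (dP t).neg.exp
  have tp : ∀ (t : ℝ) (k : ℕ), t * (k * t ^ (k - 1)) = k * t ^ k := by
    intro t k
    cases k with
    | zero => simp
    | succ k =>
      simp only [Nat.add_sub_cancel]
      ring
  have hanti : AntitoneOn (fun t => Φ t * Real.exp (-P t)) (Set.Icc 0 1) := by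
    apply antitoneOn_of_deriv_nonpos (convex_Icc 0 1)
    · exact fun t _ => (dh t).continuousAt.continuousWithinAt
    · exact fun t _ => (dh t).differentiableAt.differentiableWithinAt
    · intro t ht
      rw [interior_Icc] at ht
      rw [(dh t).deriv]
      set A1 := ∑ β ∈ Finset.Iic α, F β * (d β * t ^ (d β - 1)) with hA1
      set A2 := ∑ β ∈ lowerMulti α, w β * (d β * t ^ (d β - 1)) with hA2
      have e1 : t * A1 = ∑ β ∈ Finset.Iic α, (d β * F β) * t ^ d β := by
        rw [hA1, Finset.mul_sum]
        refine Finset.sum_congr rfl fun β _ => ?_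
        linear_combination F β * tp t (d β)
      have e2 : t * A2 = ∑ β ∈ Finset.Iic α, (d β * w β * t ^ d β) := by
        rw [hA2, Finset.mul_sum]
        unfold lowerMulti
        rw [← Finset.sum_erase (s := Finset.Iic α) (a := 0)
          (f := fun β => (d β * w β * t ^ d β : ℝ)) (by simp [(hd0 0).2 rfl])]
        refine Finset.sum_congr rfl fun β _ => ?_
        linear_combination w β * tp t (d β)
      have key : t * A1 ≤ (t * A2) * Φ t := by
        rw [e1, e2]
        have ht0 := ht.1.le
        refine le_trans ?_ (double_sum α (fun β => d β * w β * t ^ d β) (fun β => F β * t ^ d β)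
          (fun β _ => by have := hw β; positivity) (fun β => by have := hF β; positivity))
        apply Finset.sum_le_sum
        intro β hβ
        rw [Finset.mem_Iic] at hβ
        refine (mul_le_mul_of_nonneg_right (h β hβ) (by positivity)).trans (le_of_eq ?_)
        rw [Finset.sum_mul]
        apply Finset.sum_congr rfl
        intro γ hγ
        rw [hd β γ (Finset.mem_Iic.1 hγ), pow_add]
        ring
      have key2 : A1 ≤ A2 * Φ t := by
        apply le_of_mul_le_mul_left _ ht.1
        linarith
      have := mul_le_mul_of_nonneg_right key2 (Real.exp_pos (-P t)).le
      simp only [Pi.neg_apply] at *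
      linarith
  have h01 := hanti (Set.left_mem_Icc.2 zero_le_one) (Set.right_mem_Icc.2 zero_le_one) zero_le_one
  have P0 : P 0 = 0 := by
    apply Finset.sum_eq_zero
    intro β hβ
    have : β ≠ 0 := Finset.ne_of_mem_erase hβ
    have : d β ≠ 0 := fun h => this ((hd0 β).1 h)
    simp [this]
  have Φ0 : Φ 0 = F 0 := by
    rw [hΦ]
    simp only
    rw [Finset.sum_eq_single 0]
    · simp [(hd0 0).2 rfl]
    · intro β _ hβ
      have : d β ≠ 0 := fun h => hβ ((hd0 β).1 h)
      simp [this]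
    · intro h
      simp at h
  have P1 : P 1 = ∑ γ ∈ lowerMulti α, w γ := by simp [hP]
  have Φ1 : F α ≤ Φ 1 := by
    simp only [hΦ, one_pow, mul_one]
    exact Finset.single_le_sum (f := F) (fun β _ => hF β) (Finset.mem_Iic.2 le_rfl)
  simp only [P0, Φ0, P1, neg_zero, Real.exp_zero, mul_one, Real.exp_neg] at h01
  rw [← div_eq_mul_inv, div_le_iff₀ (Real.exp_pos _)] at h01
  nlinarith [Real.exp_pos (∑ γ ∈ lowerMulti α, w γ)]

end helpers

/-- If `W : ℝⁿ → ℝ` is smooth with `W ≤ 0`, `α ≠ 0` is a multi-index, and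
`∂^β W` is bounded for every nonzero `β ≤ α`, then for every `x`,
`|∂^α(e^W)(x)| ≤ α! exp(∑_{0≠β≤α} ‖∂^β W‖_∞/β!)`. -/
theorem deriv_exp_neg_bound
    (n : ℕ) (W : (Fin n → ℝ) → ℝ) (hW : ContDiff ℝ (⊤ : ℕ∞) W) (hWle : ∀ y, W y ≤ 0)
    (α : Fin n → ℕ) (hα : α ≠ 0)
    (hbdd : ∀ β ∈ lowerMulti α, ∃ M : ℝ, ∀ y, |mderiv β W y| ≤ M) (x : Fin n → ℝ) :
    |mderiv α (fun y => Real.exp (W y)) x| ≤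
      (mfact α : ℝ) *
        Real.exp (∑ β ∈ lowerMulti α, (⨆ y, |mderiv β W y|) / (mfact β : ℝ)) := by
  have key := gronwall_key α (fun β => |tc (fun y => Real.exp (W y)) x β|)
    (fun β => (⨆ y, |mderiv β W y|) / (mfact β : ℝ)) (fun β => abs_nonneg _) ?_ ?_
    (fun β => ∑ j, β j) ?_ ?_ ?_
  · simp only [tc, abs_div, abs_of_pos (mfact_pos α)] at key
    rw [div_le_iff₀ (mfact_pos α)] at key
    linarith
  · simp [tc, mderiv_zero_s11, mfact, hWle x]
  · intro β
    exact div_nonneg (Real.iSup_nonneg fun y => abs_nonneg _) (mfact_pos β).le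
  · intro β
    simp [funext_iff]
  · intro β γ hγ
    rw [← Finset.sum_add_distrib]
    refine Finset.sum_congr rfl fun j _ => ?_
    have : γ j ≤ β j := hγ j
    simp only [Pi.sub_apply]
    omega
  · intro β hβ
    have e : ((∑ j, β j : ℕ) : ℝ) * tc (fun y => Real.exp (W y)) x β =
        ∑ γ ∈ Finset.Iic β, ((∑ j, γ j : ℕ) : ℝ) * tc W x γ *
          tc (fun y => Real.exp (W y)) x (β - γ) := by
      push_cast
      simp_rw [Finset.sum_mul]
      rw [Finset.sum_comm]
      exact Finset.sum_congr rfl fun j _ => tc_exp hW x j β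
    have e' := congrArg abs e
    rw [abs_mul, Nat.abs_cast] at e'
    rw [e']
    refine (Finset.abs_sum_le_sum_abs _ _).trans (Finset.sum_le_sum fun γ hγ => ?_)
    rw [abs_mul, abs_mul, Nat.abs_cast]
    apply mul_le_mul_of_nonneg_right _ (abs_nonneg _)
    by_cases h0 : γ = 0
    · simp [h0]
    · apply mul_le_mul_of_nonneg_left _ (Nat.cast_nonneg _)
      rw [tc, abs_div, abs_of_pos (mfact_pos γ)]
      apply div_le_div_of_nonneg_right _ (mfact_pos γ).le
      obtain ⟨M, hM⟩ := hbdd γ (Finset.mem_erase.2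
        ⟨h0, Finset.mem_Iic.2 ((Finset.mem_Iic.1 hγ).trans hβ)⟩)
      exact le_ciSup (f := fun y => |mderiv γ W y|) ⟨M, by rintro _ ⟨y, rfl⟩; exact hM y⟩ x
end
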